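/- Let 1 ≤ p < q and set 1/r = 1/p − 1/q. For every positive semidefinite Y ∈ M_n ⊗ M_m, Ψ_{p,q}(Y)^p = sup{ Tr[(B^{p/r} ⊗ I_m) Y^p] : B ∈ M_n, B ≥ 0, Tr B = 1 }. -/

import Mathlib

open scoped Kronecker
open Matrix
open scoped ENNReal NNReal ComplexOrder

noncomputable section

open scoped Classical in
/-- The Schatten `p`-norm of a complex square matrix, `p ∈ [1,∞]` (as an `ℝ≥0∞`).
For finite `p` it equals `(Tr |A|^p)^{1/p}`, computed via the eigenvalues of `Aᴴ * A`;
for `p = ∞` it is the operator norm (largest singular value). -/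
noncomputable def schattenNorm {k : Type*} [Fintype k] [DecidableEq k] (p : ℝ≥0∞)
    (A : Matrix k k ℂ) : ℝ :=
  if p = ⊤ then
    ⨆ i, Real.sqrt ((Matrix.posSemidef_conjTranspose_mul_self A).isHermitian.eigenvalues i)
  else
    (∑ i, (Matrix.posSemidef_conjTranspose_mul_self A).isHermitian.eigenvalues i
        ^ (p.toReal / 2)) ^ (1 / p.toReal)

/-- `r` defined by `1/r = max{1/p, 1/q} - min{1/p, 1/q}` (so `r = ∞` when `p = q`). -/
noncomputable def ncR (p q : ℝ≥0∞) : ℝ≥0∞ := (max p⁻¹ q⁻¹ - min p⁻¹ q⁻¹)⁻¹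

/-- The non-commutative `L^q(L^p)` norm (supremum form, used when `p ≤ q`):
`sup_{A,B} ‖(A ⊗ I) Y (B ⊗ I)‖_p / (‖A‖_{2r} ‖B‖_{2r})`. -/
noncomputable def ncNormSup {k l : Type*} [Fintype k] [DecidableEq k] [Fintype l] [DecidableEq l]
    (p q : ℝ≥0∞) (Y : Matrix (k × l) (k × l) ℂ) : ℝ :=
  ⨆ A : Matrix k k ℂ, ⨆ B : Matrix k k ℂ,
    schattenNorm p ((A ⊗ₖ (1 : Matrix l l ℂ)) * Y * (B ⊗ₖ (1 : Matrix l l ℂ))) /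
      (schattenNorm (2 * ncR p q) A * schattenNorm (2 * ncR p q) B)

/-- The non-commutative `L^q(L^p)` norm (infimum form, used when `q ≤ p`):
`inf { ∑ᵢ ‖Aᵢ‖_{2r} ‖Bᵢ‖_{2r} ‖Zᵢ‖_p : Y = ∑ᵢ (Aᵢ ⊗ I) Zᵢ (Bᵢ ⊗ I) }`. -/
noncomputable def ncNormInf {k l : Type*} [Fintype k] [DecidableEq k] [Fintype l] [DecidableEq l]
    (p q : ℝ≥0∞) (Y : Matrix (k × l) (k × l) ℂ) : ℝ :=
  sInf { s : ℝ | ∃ (N : ℕ) (A B : Fin N → Matrix k k ℂ)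
      (Z : Fin N → Matrix (k × l) (k × l) ℂ),
    Y = ∑ i, (A i ⊗ₖ (1 : Matrix l l ℂ)) * Z i * (B i ⊗ₖ (1 : Matrix l l ℂ)) ∧
    s = ∑ i, schattenNorm (2 * ncR p q) (A i) * schattenNorm (2 * ncR p q) (B i) *
          schattenNorm p (Z i) }

open scoped Classical in
/-- The non-commutative `L^q(L^p)` norm `‖·‖_{NC:p,q}`. -/
noncomputable def ncNorm {k l : Type*} [Fintype k] [DecidableEq k] [Fintype l] [DecidableEq l]
    (p q : ℝ≥0∞) (Y : Matrix (k × l) (k × l) ℂ) : ℝ :=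
  if p ≤ q then ncNormSup p q Y else ncNormInf p q Y

open scoped Classical in
/-- Real power of a Hermitian matrix via the spectral decomposition (junk value `0` on
non-Hermitian matrices). -/
noncomputable def mrpow {k : Type*} [Fintype k] [DecidableEq k] (A : Matrix k k ℂ) (e : ℝ) :
    Matrix k k ℂ :=
  if hA : A.IsHermitian then
    (hA.eigenvectorUnitary : Matrix k k ℂ) *
      Matrix.diagonal (fun i => ((hA.eigenvalues i ^ e : ℝ) : ℂ)) *
      ((hA.eigenvectorUnitary : Matrix k k ℂ))ᴴ
  else 0

/-- Partial trace over the second (inside) factor. -/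
noncomputable def ptrace2 {k l : Type*} [Fintype l]
    (Y : Matrix (k × l) (k × l) ℂ) : Matrix k k ℂ :=
  fun i i' => ∑ j : l, Y (i, j) (i', j)

/-- The Carlen–Lieb quantity `Ψ_{p,q}(Y) = (Tr₁ (Tr₂ Y^p)^{q/p})^{1/q}`. -/
noncomputable def Psi {k l : Type*} [Fintype k] [DecidableEq k] [Fintype l] [DecidableEq l]
    (p q : ℝ) (Y : Matrix (k × l) (k × l) ℂ) : ℝ :=
  (Matrix.trace (mrpow (ptrace2 (mrpow Y p)) (q / p))).re ^ (1 / q)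

/-- The quantity `|||X|||_{p,q} = inf {Ψ_{p,q}(A) + Ψ_{p,q}(B) : X + A = B, A ≥ 0, B ≥ 0}`,
for `X` on the space `M_k ⊗ (M_l ⊗ M_2)`. -/
noncomputable def tripleNorm {k l : Type*} [Fintype k] [DecidableEq k] [Fintype l] [DecidableEq l]
    (p q : ℝ) (X : Matrix (k × (l × Fin 2)) (k × (l × Fin 2)) ℂ) : ℝ :=
  sInf { s : ℝ | ∃ A B : Matrix (k × (l × Fin 2)) (k × (l × Fin 2)) ℂ,
    A.PosSemidef ∧ B.PosSemidef ∧ X + A = B ∧ s = Psi p q A + Psi p q B }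

/-- The block matrix `[[0, Y],[Yᴴ, 0]]`, viewed in `M_k ⊗ (M_l ⊗ M_2)`. -/
noncomputable def clBlock {k l : Type*} (Y : Matrix (k × l) (k × l) ℂ) :
    Matrix (k × (l × Fin 2)) (k × (l × Fin 2)) ℂ :=
  fun x y =>
    if x.2.2 = 0 ∧ y.2.2 = 1 then Y (x.1, x.2.1) (y.1, y.2.1)
    else if x.2.2 = 1 ∧ y.2.2 = 0 then star (Y (y.1, y.2.1) (x.1, x.2.1))
    else 0

/-- The block-diagonal matrix `diag(P, Q) = [[P, 0],[0, Q]]`, viewed in `M_k ⊗ (M_l ⊗ M_2)`. -/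
noncomputable def blockDiag2 {k l : Type*} (P Q : Matrix (k × l) (k × l) ℂ) :
    Matrix (k × (l × Fin 2)) (k × (l × Fin 2)) ℂ :=
  fun x y =>
    if x.2.2 = 0 ∧ y.2.2 = 0 then P (x.1, x.2.1) (y.1, y.2.1)
    else if x.2.2 = 1 ∧ y.2.2 = 1 then Q (x.1, x.2.1) (y.1, y.2.1)
    else 0

/-- The Carlen–Lieb norm `‖Y‖_{CL} = (1/2) ||| [[0,Y],[Yᴴ,0]] |||_{p,q}`. -/
noncomputable def clNorm {k l : Type*} [Fintype k] [DecidableEq k] [Fintype l] [DecidableEq l]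
    (p q : ℝ) (Y : Matrix (k × l) (k × l) ℂ) : ℝ :=
  (1 / 2) * tripleNorm p q (clBlock Y)

end

lemma mrpow_eq_cfc {k : Type*} [Fintype k] [DecidableEq k] {A : Matrix k k ℂ}
    (hA : A.IsHermitian) (e : ℝ) : mrpow A e = cfc (fun x : ℝ => x ^ e) A := by
  rw [hA.cfc_eq, mrpow, dif_pos hA, Matrix.IsHermitian.cfc, Unitary.conjStarAlgAut_apply]
  rfl

lemma continuousOn_spectrum_real {k : Type*} [Fintype k] [DecidableEq k] (A : Matrix k k ℂ)
    (f : ℝ → ℝ) : ContinuousOn f (spectrum ℝ A) :=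
  A.finite_real_spectrum.continuousOn f

lemma continuousOn_image_spectrum_real {k : Type*} [Fintype k] [DecidableEq k]
    (A : Matrix k k ℂ) (f g : ℝ → ℝ) : ContinuousOn g (f '' spectrum ℝ A) :=
  (A.finite_real_spectrum.image f).continuousOn g

lemma trace_cfc {k : Type*} [Fintype k] [DecidableEq k] {A : Matrix k k ℂ}
    (hA : A.IsHermitian) (f : ℝ → ℝ) :
    (cfc f A).trace = ((∑ i, f (hA.eigenvalues i) : ℝ) : ℂ) := by
  rw [hA.cfc_eq, Matrix.IsHermitian.cfc, Unitary.conjStarAlgAut_apply, Matrix.trace_mul_comm,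
    ← Matrix.mul_assoc, Unitary.coe_star_mul_self, Matrix.one_mul]
  simp [Matrix.trace]

lemma posSemidef_cfc {k : Type*} [Fintype k] [DecidableEq k] {A : Matrix k k ℂ}
    (hA : A.IsHermitian) {f : ℝ → ℝ} (hf : ∀ i, 0 ≤ f (hA.eigenvalues i)) :
    (cfc f A).PosSemidef := by
  rw [hA.cfc_eq, Matrix.IsHermitian.cfc, Unitary.conjStarAlgAut_apply]
  refine Matrix.PosSemidef.mul_mul_conjTranspose_same
    (Matrix.PosSemidef.diagonal fun i => ?_) _
  exact Complex.zero_le_real.mpr (hf i)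

lemma posSemidef_mrpow {k : Type*} [Fintype k] [DecidableEq k] {A : Matrix k k ℂ}
    (hA : A.PosSemidef) (e : ℝ) : (mrpow A e).PosSemidef := by
  rw [mrpow_eq_cfc hA.1]
  exact posSemidef_cfc hA.1 fun i => Real.rpow_nonneg (hA.eigenvalues_nonneg i) e

lemma posSemidef_ptrace2 {k l : Type*} [Fintype k] [Fintype l]
    {Z : Matrix (k × l) (k × l) ℂ} (hZ : Z.PosSemidef) : (ptrace2 Z).PosSemidef := by
  have h : ptrace2 Z = ∑ j : l, Z.submatrix (fun i => (i, j)) (fun i => (i, j)) := by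
    ext i i'
    simp [ptrace2, Matrix.sum_apply]
  rw [h]
  exact Matrix.posSemidef_sum _ fun j _ => hZ.submatrix _

lemma trace_kronecker_one_mul {k l : Type*} [Fintype k] [Fintype l] [DecidableEq l]
    (C : Matrix k k ℂ) (Z : Matrix (k × l) (k × l) ℂ) :
    ((C ⊗ₖ (1 : Matrix l l ℂ)) * Z).trace = (C * ptrace2 Z).trace := by
  simp only [Matrix.trace, Matrix.diag_apply, Matrix.mul_apply, Fintype.sum_prod_type,
    Matrix.kroneckerMap_apply, Matrix.one_apply, ptrace2, Finset.mul_sum, mul_ite, mul_one,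
    mul_zero, ite_mul, zero_mul, Finset.sum_ite_eq, Finset.mem_univ, if_true]
  exact Finset.sum_congr rfl fun i _ => Finset.sum_comm

/-- The trace of a product of two functions of Hermitian matrices, weighted by the squared
overlaps of the eigenbases, which form a doubly stochastic matrix. -/
lemma exists_overlap_trace_cfc_mul_cfc {k : Type*} [Fintype k] [DecidableEq k]
    {A B : Matrix k k ℂ} (hA : A.IsHermitian) (hB : B.IsHermitian) :
    ∃ w : k → k → ℝ, (∀ i j, 0 ≤ w i j) ∧ (∀ i, ∑ j, w i j = 1) ∧ (∀ j, ∑ i, w i j = 1) ∧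
      ∀ f g : ℝ → ℝ, (cfc f A * cfc g B).trace =
        ((∑ i, ∑ j, w i j * f (hA.eigenvalues i) * g (hB.eigenvalues j) : ℝ) : ℂ) := by
  set W : Matrix k k ℂ :=
    (star (hA.eigenvectorUnitary : Matrix k k ℂ)) * (hB.eigenvectorUnitary : Matrix k k ℂ) with hW
  have hmem : W ∈ unitary (Matrix k k ℂ) :=
    (star hA.eigenvectorUnitary * hB.eigenvectorUnitary : unitary _).2
  have hrow : W * star W = 1 := Unitary.mul_star_self_of_mem hmem
  have hcol : star W * W = 1 := Unitary.star_mul_self_of_mem hmem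
  have hnorm : ∀ i j, W i j * star (W i j) = (Complex.normSq (W i j) : ℂ) := fun i j =>
    Complex.mul_conj _
  refine ⟨fun i j => Complex.normSq (W i j), fun i j => Complex.normSq_nonneg _, fun i => ?_,
    fun j => ?_, fun f g => ?_⟩
  · have h := Matrix.ext_iff.mpr hrow i i
    simp only [Matrix.mul_apply, Matrix.star_apply, hnorm, Matrix.one_apply_eq] at h
    exact_mod_cast h
  · have h := Matrix.ext_iff.mpr hcol j j
    simp only [Matrix.mul_apply, Matrix.star_apply, mul_comm (star _), hnorm,
      Matrix.one_apply_eq] at h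
    exact_mod_cast h
  · have key : (cfc f A * cfc g B).trace =
        (diagonal (fun i => (f (hA.eigenvalues i) : ℂ)) * W *
          diagonal (fun j => (g (hB.eigenvalues j) : ℂ)) * star W).trace := by
      rw [hA.cfc_eq, hB.cfc_eq, Matrix.IsHermitian.cfc, Matrix.IsHermitian.cfc,
        Unitary.conjStarAlgAut_apply, Unitary.conjStarAlgAut_apply, Matrix.mul_assoc,
        Matrix.mul_assoc, Matrix.trace_mul_comm, hW]
      simp only [star_mul, star_star, Matrix.mul_assoc]
      rfl
    rw [key]
    simp only [Matrix.trace, Matrix.diag_apply, Matrix.mul_apply (N := star W),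
      Matrix.mul_diagonal, Matrix.diagonal_mul, Matrix.star_apply]
    push_cast
    refine Finset.sum_congr rfl fun i _ => Finset.sum_congr rfl fun j _ => ?_
    rw [← hnorm]
    ring

lemma weighted_holder {ι : Type*} (t : Finset ι) {w x y : ι → ℝ} {s : ℝ} (hs : 1 < s)
    (hw : ∀ i ∈ t, 0 ≤ w i) (hx : ∀ i ∈ t, 0 ≤ x i) (hy : ∀ i ∈ t, 0 ≤ y i) :
    ∑ i ∈ t, w i * x i ^ (1 - 1 / s) * y i ≤
      (∑ i ∈ t, w i * x i) ^ (1 - 1 / s) * (∑ i ∈ t, w i * y i ^ s) ^ (1 / s) := by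
  have hs0 : 0 < s := by linarith
  have hθ : 0 < 1 - 1 / s := by
    rw [sub_pos, div_lt_one hs0]
    exact hs
  have hconj : (1 / (1 - 1 / s)).HolderConjugate s := by
    rw [Real.holderConjugate_iff]
    constructor
    · rw [lt_div_iff₀ hθ]
      linarith [one_div_pos.mpr hs0]
    · simp
  have h := Real.inner_le_Lp_mul_Lq_of_nonneg t (f := fun i => (w i * x i) ^ (1 - 1 / s))
    (g := fun i => (w i * y i ^ s) ^ (1 / s)) hconj
    (fun i hi => Real.rpow_nonneg (mul_nonneg (hw i hi) (hx i hi)) _)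
    (fun i hi => Real.rpow_nonneg (mul_nonneg (hw i hi) (Real.rpow_nonneg (hy i hi) _)) _)
  rw [one_div_one_div] at h
  convert h using 1
  · refine Finset.sum_congr rfl fun i hi => ?_
    rw [Real.mul_rpow (hw i hi) (hx i hi), Real.mul_rpow (hw i hi) (Real.rpow_nonneg (hy i hi) _),
      ← Real.rpow_mul (hy i hi), mul_one_div_cancel hs0.ne', Real.rpow_one]
    have hwi : w i = w i ^ (1 - 1 / s) * w i ^ (1 / s) := by
      rw [← Real.rpow_add' (hw i hi) (by simp), sub_add_cancel, Real.rpow_one]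
    conv_lhs => rw [hwi]
    ring
  · congr 2
    · refine Finset.sum_congr rfl fun i hi => ?_
      rw [← Real.rpow_mul (mul_nonneg (hw i hi) (hx i hi)), mul_one_div_cancel hθ.ne',
        Real.rpow_one]
    · refine Finset.sum_congr rfl fun i hi => ?_
      rw [← Real.rpow_mul (mul_nonneg (hw i hi) (Real.rpow_nonneg (hy i hi) _)),
        one_div_mul_cancel hs0.ne', Real.rpow_one]

/-- Duality of the Schatten norms, in the form of a maximum over density matrices. -/
lemma isGreatest_trace_mrpow_mul {k : Type*} [Fintype k] [DecidableEq k] [Nonempty k]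
    {A : Matrix k k ℂ} (hA : A.PosSemidef) {s : ℝ} (hs : 1 < s) :
    IsGreatest {x : ℝ | ∃ B : Matrix k k ℂ, B.PosSemidef ∧ B.trace = 1 ∧
      x = (mrpow B (1 - 1 / s) * A).trace.re} ((mrpow A s).trace.re ^ (1 / s)) := by
  have hs0 : 0 < s := by linarith
  have hid : ∀ {C : Matrix k k ℂ}, C.IsHermitian → cfc (fun x : ℝ => x) C = C :=
    fun {C} hC => cfc_id' ℝ C hC
  set l := hA.1.eigenvalues with hl
  have hl0 : ∀ i, 0 ≤ l i := hA.eigenvalues_nonneg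
  have htr : (mrpow A s).trace.re = ∑ i, l i ^ s := by
    rw [mrpow_eq_cfc hA.1, trace_cfc hA.1, Complex.ofReal_re]
  have hS0 : 0 ≤ ∑ i, l i ^ s := Finset.sum_nonneg fun i _ => Real.rpow_nonneg (hl0 i) _
  rw [htr]
  have upper : ∀ B : Matrix k k ℂ, B.PosSemidef → B.trace = 1 →
      0 ≤ (mrpow B (1 - 1 / s) * A).trace.re ∧
      (mrpow B (1 - 1 / s) * A).trace.re ≤ (∑ i, l i ^ s) ^ (1 / s) := by
    intro B hB hB1
    obtain ⟨w, hw, hrow, hcol, hw_tr⟩ := exists_overlap_trace_cfc_mul_cfc hB.1 hA.1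
    have hb0 := hB.eigenvalues_nonneg
    have hb1 : ∑ i, hB.1.eigenvalues i = 1 := by
      have h := trace_cfc hB.1 (fun x => x)
      rw [hid hB.1, hB1] at h
      exact_mod_cast h.symm
    have hval : (mrpow B (1 - 1 / s) * A).trace.re =
        ∑ i, ∑ j, w i j * hB.1.eigenvalues i ^ (1 - 1 / s) * l j := by
      have h := hw_tr (fun x => x ^ (1 - 1 / s)) (fun x => x)
      rw [hid hA.1] at h
      rw [mrpow_eq_cfc hB.1, h, Complex.ofReal_re]
    rw [hval]
    refine ⟨Finset.sum_nonneg fun i _ => Finset.sum_nonneg fun j _ =>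
      mul_nonneg (mul_nonneg (hw i j) (Real.rpow_nonneg (hb0 i) _)) (hl0 j), ?_⟩
    have h := weighted_holder (Finset.univ : Finset (k × k)) (w := fun a => w a.1 a.2)
      (x := fun a => hB.1.eigenvalues a.1) (y := fun a => l a.2) hs
      (fun a _ => hw _ _) (fun a _ => hb0 _) (fun a _ => hl0 _)
    simp only [Fintype.sum_prod_type] at h
    have h1 : ∑ i, ∑ j, w i j * hB.1.eigenvalues i = 1 := by
      simp only [← Finset.sum_mul, hrow, one_mul, hb1]
    have h2 : ∑ i, ∑ j, w i j * l j ^ s = ∑ j, l j ^ s := by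
      rw [Finset.sum_comm]
      simp only [← Finset.sum_mul, hcol, one_mul]
    rwa [h1, h2, Real.one_rpow, one_mul] at h
  refine ⟨?_, ?_⟩
  · rcases hS0.eq_or_lt with hS | hS
    · let B : Matrix k k ℂ := (Fintype.card k : ℂ)⁻¹ • 1
      have hB : B.PosSemidef := Matrix.PosSemidef.one.smul (by positivity)
      have hB1 : B.trace = 1 := by simp [B]
      refine ⟨B, hB, hB1, le_antisymm ?_ (upper B hB hB1).2⟩
      rw [← hS, Real.zero_rpow (one_div_ne_zero hs0.ne')]
      exact (upper B hB hB1).1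
    · set S := ∑ i, l i ^ s with hSdef
      have hB : (cfc (fun x : ℝ => x ^ s / S) A).PosSemidef :=
        posSemidef_cfc hA.1 fun i => div_nonneg (Real.rpow_nonneg (hl0 i) _) hS0
      refine ⟨_, hB, ?_, ?_⟩
      · rw [trace_cfc hA.1, ← Finset.sum_div, ← hl, ← hSdef, div_self hS.ne', Complex.ofReal_one]
      · have hcomp : mrpow (cfc (fun x : ℝ => x ^ s / S) A) (1 - 1 / s) * A =
            cfc (fun x : ℝ => (x ^ s / S) ^ (1 - 1 / s) * x) A := by
          have hpow : cfc (fun x : ℝ => (x ^ s / S) ^ (1 - 1 / s)) A =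
              cfc (fun x : ℝ => x ^ (1 - 1 / s)) (cfc (fun x : ℝ => x ^ s / S) A) :=
            cfc_comp' (fun x : ℝ => x ^ (1 - 1 / s)) (fun x : ℝ => x ^ s / S) A
              (continuousOn_image_spectrum_real _ _ _) (continuousOn_spectrum_real _ _) hA.1
          rw [cfc_mul _ _ A (continuousOn_spectrum_real _ _) (continuousOn_spectrum_real _ _),
            hid hA.1, mrpow_eq_cfc hB.1, hpow]
        have hterm : ∀ i, (l i ^ s / S) ^ (1 - 1 / s) * l i = l i ^ s / S ^ (1 - 1 / s) := by
          intro i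
          rw [Real.div_rpow (Real.rpow_nonneg (hl0 i) _) hS0, ← Real.rpow_mul (hl0 i),
            div_mul_eq_mul_div, show s * (1 - 1 / s) = s - 1 by field_simp]
          congr 1
          nth_rewrite 2 [← Real.rpow_one (l i)]
          rw [← Real.rpow_add' (hl0 i) (by simpa using hs0.ne'), sub_add_cancel]
        rw [hcomp, trace_cfc hA.1, Complex.ofReal_re, ← hl, Finset.sum_congr rfl fun i _ => hterm i,
          ← Finset.sum_div, ← hSdef]
        nth_rewrite 2 [← Real.rpow_one S]
        rw [← Real.rpow_sub hS, sub_sub_cancel]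
  · rintro x ⟨B, hB, hB1, rfl⟩
    exact (upper B hB hB1).2

/-- **Variational formula for `Ψ_{p,q}(Y)^p`** (`1 ≤ p < q`):
`Ψ_{p,q}(Y)^p = sup { Tr[(B^{p/r} ⊗ I) Y^p] : B ≥ 0, Tr B = 1 }` where `1/r = 1/p - 1/q`. -/
theorem psi_pow_eq_sup_density {n m : ℕ} (hn : 0 < n) (hm : 0 < m) (p q r : ℝ)
    (hp : 1 ≤ p) (hpq : p < q) (hr : 1 / r = 1 / p - 1 / q)
    (Y : Matrix (Fin n × Fin m) (Fin n × Fin m) ℂ) (hY : Y.PosSemidef) :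
    Psi p q Y ^ p = sSup { x : ℝ | ∃ B : Matrix (Fin n) (Fin n) ℂ,
      B.PosSemidef ∧ B.trace = 1 ∧
      x = (Matrix.trace
        ((mrpow B (p / r) ⊗ₖ (1 : Matrix (Fin m) (Fin m) ℂ)) * mrpow Y p)).re } := by
  have : Nonempty (Fin n) := ⟨⟨0, hn⟩⟩
  have hp0 : 0 < p := by linarith
  have hq0 : 0 < q := by linarith
  have hs : 1 < q / p := (one_lt_div hp0).mpr hpq
  have hθ : p / r = 1 - 1 / (q / p) := by
    rw [div_eq_mul_one_div, hr]
    field_simp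
  have hA : (ptrace2 (mrpow Y p)).PosSemidef := posSemidef_ptrace2 (posSemidef_mrpow hY p)
  have hT : 0 ≤ (mrpow (ptrace2 (mrpow Y p)) (q / p)).trace.re :=
    (Complex.nonneg_iff.mp (posSemidef_mrpow hA (q / p)).trace_nonneg).1
  simp only [trace_kronecker_one_mul, hθ]
  rw [(isGreatest_trace_mrpow_mul hA hs).csSup_eq, Psi, ← Real.rpow_mul hT]
  congr 1
  field_simp
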